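/- Let F be a discretely valued Henselian field with perfect residue field and E/F a finitely ramified separable algebraic extension. Then the Herbrand function φ_{E/F}(r) = ∫_0^r (g_t/g_0) dt is a piecewise-linear, continuous, strictly increasing bijection from [0,∞) onto [0,∞) (a self-homeomorphism of [0,∞)); in particular it admits an inverse self-homeomorphism ψ_{E/F} of [0,∞). -/

import Mathlib

noncomputable section

open scoped Classical

/-- An additive `ℝ ∪ {⊤}`-valued valuation on a field `Ω`. -/
structure AddVal (Ω : Type*) [Field Ω] where
  v : Ω → WithTop ℝ
  v_zero : v 0 = ⊤
  v_ne_top : ∀ x : Ω, x ≠ 0 → v x ≠ ⊤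
  v_mul : ∀ x y : Ω, v (x * y) = v x + v y
  v_min_le_add : ∀ x y : Ω, min (v x) (v y) ≤ v (x + y)

namespace AddVal

variable {Ω : Type*} [Field Ω]

/-- `V` is normalized on `F`: its value group on `F^×` is exactly `ℤ`.
This encodes that `F` is a discretely valued field and `V` extends the
normalized discrete valuation `val_F` of `F`. -/
def IsNormalizedOn (V : AddVal Ω) (F : Type*) [Field F] [Algebra F Ω] : Prop :=
  (∀ x : F, x ≠ 0 → ∃ k : ℤ, V.v (algebraMap F Ω x) = ((k : ℝ) : WithTop ℝ)) ∧
    (∃ x : F, V.v (algebraMap F Ω x) = ((1 : ℝ) : WithTop ℝ))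

/-- Henselian property of the valued field `(F, val_F)` (simple-root Hensel lemma). -/
def IsHenselianOn (V : AddVal Ω) (F : Type*) [Field F] [Algebra F Ω] : Prop :=
  ∀ f : Polynomial F,
    (∀ i : ℕ, 0 ≤ V.v (algebraMap F Ω (f.coeff i))) →
      ∀ a₀ : F, 0 ≤ V.v (algebraMap F Ω a₀) →
        0 < V.v (algebraMap F Ω (Polynomial.eval a₀ f)) →
        V.v (algebraMap F Ω (Polynomial.eval a₀ (Polynomial.derivative f))) = 0 →
        ∃ a : F, Polynomial.eval a f = 0 ∧ 0 < V.v (algebraMap F Ω (a - a₀))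

/-- The residue field of `(F, val_F)` is perfect: in positive residue characteristic `p`,
the Frobenius is surjective on the residue field. -/
def HasPerfectResidueFieldOn (V : AddVal Ω) (F : Type*) [Field F] [Algebra F Ω] : Prop :=
  ∀ p : ℕ, p.Prime → 0 < V.v (algebraMap F Ω (p : F)) →
    ∀ x : F, 0 ≤ V.v (algebraMap F Ω x) →
      ∃ y : F, 0 ≤ V.v (algebraMap F Ω y) ∧ 0 < V.v (algebraMap F Ω (x - y ^ p))

/-- `e` is the (absolute) ramification index of `E` over the field on which `V` is
normalized: the value group of `E^×` is exactly `(1/e)ℤ`.  In particular `E` is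
finitely ramified. -/
def IsRamIdx (V : AddVal Ω) {K : Type*} [Field K] [Algebra K Ω]
    (E : IntermediateField K Ω) (e : ℕ) : Prop :=
  0 < e ∧
    (∀ x : ↥E, x ≠ 0 → ∃ k : ℤ, V.v (x : Ω) = ((((k : ℝ) / (e : ℝ) : ℝ)) : WithTop ℝ)) ∧
    (∃ x : ↥E, V.v (x : Ω) = (((1 / (e : ℝ) : ℝ)) : WithTop ℝ))

end AddVal

/-- The lower ramification relation `Ξ_r` on `K`-algebra embeddings of `E` into `Ω`,
where `e` is the absolute ramification index of `E` (over the normalization field of `V`):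
`σ Ξ_r τ` iff `val_M (σ x - τ x) ≥ e(M/E) (r+1)` for all integral `x` and any (equivalently
some) suitable Galois `M`; this is equivalent to `V.v (σ x - τ x) ≥ (r+1)/e` for all
integral `x`. -/
def xiRel {Ω : Type*} [Field Ω] (V : AddVal Ω) {K : Type*} [Field K] [Algebra K Ω]
    (E : IntermediateField K Ω) (e : ℕ) (r : ℝ) (σ τ : ↥E →ₐ[K] Ω) : Prop :=
  ∀ x : ↥E, 0 ≤ V.v (x : Ω) →
    ((((r + 1) / (e : ℝ) : ℝ)) : WithTop ℝ) ≤ V.v (σ x - τ x)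

/-- `g_t`: the (common) cardinality of a `Ξ_t`-equivalence class, realized as the
cardinality of the class of the inclusion `E ↪ Ω`. -/
def gfun {Ω : Type*} [Field Ω] (V : AddVal Ω) {K : Type*} [Field K] [Algebra K Ω]
    (E : IntermediateField K Ω) (e : ℕ) (t : ℝ) : ℕ :=
  Nat.card {σ : ↥E →ₐ[K] Ω // xiRel V E e t σ E.val}

/-- The Herbrand function `φ_{E/K}(r) = ∫_0^r (g_t / g_0) dt`. -/
def herbrand {Ω : Type*} [Field Ω] (V : AddVal Ω) {K : Type*} [Field K] [Algebra K Ω]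
    (E : IntermediateField K Ω) (e : ℕ) (r : ℝ) : ℝ :=
  ∫ t in (0:ℝ)..r, ((gfun V E e t : ℝ) / (gfun V E e 0 : ℝ))

/-- `E/K` is at most `l`-ramified: for every finite subextension `E₀/K` the relation
`Ξ^l = Ξ_{ψ_{E₀/K}(l)}` is trivial. -/
def atMostRamified {Ω : Type*} [Field Ω] (V : AddVal Ω) {K : Type*} [Field K] [Algebra K Ω]
    (E : IntermediateField K Ω) (l : ℝ) : Prop :=
  ∀ E₀ : IntermediateField K Ω, E₀ ≤ E → FiniteDimensional K ↥E₀ →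
    ∀ (e₀ : ℕ) (s : ℝ), V.IsRamIdx E₀ e₀ → 0 ≤ s → herbrand V E₀ e₀ s = l →
      ∀ σ τ : ↥E₀ →ₐ[K] Ω, xiRel V E₀ e₀ s σ τ → σ = τ

/-- Membership of `γ ∈ Γ_K` in the upper ramification subgroup `I_K^l`: for every
finite Galois subextension `M/K` (with ramification index `eM` and `ψ_{M/K}(l) = sM`),
the image of `γ` in `Gal(M/K)` lies in `Gal(M/K)^l = Gal(M/K)_{ψ_{M/K}(l)}`. -/
def inUpperRam {Ω : Type*} [Field Ω] (V : AddVal Ω) {K : Type*} [Field K] [Algebra K Ω]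
    (l : ℝ) (γ : Ω ≃ₐ[K] Ω) : Prop :=
  ∀ (M : IntermediateField K Ω) (eM : ℕ) (sM : ℝ),
    FiniteDimensional K ↥M → IsGalois K ↥M → V.IsRamIdx M eM → 0 ≤ sM →
      herbrand V M eM sM = l →
      xiRel V M eM sM (γ.toAlgHom.comp M.val) M.val


section Approximation

open Polynomial IsLocalRing

/-- Whether a polynomial takes a unit value at a point only depends on the residue class. -/
theorem isUnit_eval_of_dvd_sub {B : Type*} [CommRing B] [IsLocalRing B] {π : B}
    (hπ : π ∈ maximalIdeal B) (f : B[X]) {a b : B} (hba : π ∣ b - a) (ha : IsUnit (f.eval a)) :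
    IsUnit (f.eval b) := by
  obtain ⟨z, hz⟩ := evalSubFactor f b a
  by_contra hcon
  refine (mem_maximalIdeal _).1 ?_ ha
  rw [← sub_sub_cancel (f.eval b) (f.eval a), hz]
  exact sub_mem ((mem_maximalIdeal _).2 hcon)
    (Ideal.mul_mem_left _ _ (Ideal.mem_of_dvd _ hba hπ))

/-- Newton approximation of a simple root modulo `π`. -/
theorem exists_dvd_pow_eval {B : Type*} [CommRing B] [IsLocalRing B] {π : B}
    (hπ : π ∈ maximalIdeal B) (f : B[X]) {a : B} (ha : π ∣ f.eval a)
    (ha' : IsUnit (f.derivative.eval a)) (n : ℕ) :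
    ∃ b, π ∣ b - a ∧ π ^ (n + 1) ∣ f.eval b := by
  induction n with
  | zero => exact ⟨a, by simp, by simpa using ha⟩
  | succ n ih =>
    obtain ⟨b, hba, hb⟩ := ih
    have hb' := isUnit_eval_of_dvd_sub hπ f.derivative hba ha'
    obtain ⟨u, hu⟩ := hb'.exists_right_inv
    obtain ⟨k, hk⟩ := binomExpansion f b (-(f.eval b * u))
    obtain ⟨t, ht⟩ := hb
    refine ⟨b + -(f.eval b * u), ?_, ?_⟩
    · obtain ⟨s, hs⟩ := hba
      exact ⟨s - π ^ n * t * u, by rw [ht]; linear_combination hs⟩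
    · rw [hk]
      refine ⟨k * π ^ n * t ^ 2 * u ^ 2, ?_⟩
      rw [ht]
      linear_combination (-(π ^ (n + 1) * t)) * hu

/-- Two approximate roots that are congruent modulo `π` and reduce to a simple root are
close to each other. -/
theorem pow_dvd_sub_of_dvd_eval {A : Type*} [CommRing A] [IsLocalRing A] {π : A}
    (hπ : π ∈ maximalIdeal A) (f : A[X]) {a b : A} (hab : π ∣ b - a)
    (ha' : IsUnit (f.derivative.eval a)) {n : ℕ} (ha : π ^ n ∣ f.eval a)
    (hb : π ^ n ∣ f.eval b) : π ^ n ∣ b - a := by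
  obtain ⟨k, hk⟩ := binomExpansion f a (b - a)
  rw [add_sub_cancel] at hk
  have hu : IsUnit (f.derivative.eval a + k * (b - a)) := by
    by_contra hcon
    have h1 : k * (b - a) ∈ maximalIdeal A :=
      Ideal.mul_mem_left _ _ (Ideal.mem_of_dvd _ hab hπ)
    have := (Ideal.add_mem_iff_left _ h1).1 ((mem_maximalIdeal _).2 hcon)
    exact (mem_maximalIdeal _).1 this ha'
  rw [← hu.dvd_mul_left]
  have : (f.derivative.eval a + k * (b - a)) * (b - a) = f.eval b - f.eval a := by
    rw [hk]; ring
  rw [this]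
  exact dvd_sub hb ha

/-- `π`-adic expansions with digits in a subring `C` of representatives. -/
theorem exists_pow_dvd_sub_sum {B : Type*} [CommRing B] (C : Subring B) {π p w w' : B} {e : ℕ}
    (he : 0 < e) (hp : p ∈ C) (hw : w * w' = 1) (hπp : π ^ e = w * p)
    (hC : ∀ x, ∃ c ∈ C, π ∣ x - c) (m : ℕ) (x : B) :
    ∃ c : Fin e → B, (∀ i, c i ∈ C) ∧ π ^ m ∣ x - ∑ i, c i * π ^ (i : ℕ) := by
  induction m with
  | zero => exact ⟨0, fun _ => C.zero_mem, by simp⟩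
  | succ m ih =>
    obtain ⟨c, hc, y, hy⟩ := ih
    obtain ⟨d, hd, z, hz⟩ := hC (w ^ (m / e) * y)
    have hm : π ^ m = w ^ (m / e) * p ^ (m / e) * π ^ (m % e) := by
      conv_lhs => rw [← Nat.div_add_mod m e, pow_add, pow_mul, hπp, mul_pow]
    have hw' : w ^ (m / e) * w' ^ (m / e) = 1 := by rw [← mul_pow, hw, one_pow]
    let i₀ : Fin e := ⟨m % e, Nat.mod_lt _ he⟩
    refine ⟨c + Pi.single i₀ (p ^ (m / e) * d), fun i => ?_, w' ^ (m / e) * z, ?_⟩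
    · refine C.add_mem (hc i) ?_
      by_cases hi : i = i₀
      · subst hi
        simpa using C.mul_mem (C.pow_mem hp _) hd
      · simp [hi, C.zero_mem]
    · have hs : ∑ i, (c + Pi.single i₀ (p ^ (m / e) * d) : Fin e → B) i * π ^ (i : ℕ) =
          ∑ i, c i * π ^ (i : ℕ) + p ^ (m / e) * d * π ^ (m % e) := by
        simp only [Pi.add_apply, add_mul, Finset.sum_add_distrib]
        congr 1
        rw [Finset.sum_eq_single i₀] <;> simp +contextual [i₀]
      rw [hs, ← sub_sub, hy, pow_succ, hm]
      linear_combination (-(p ^ (m / e) * π ^ (m % e) * π * z)) * hw' +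
        (p ^ (m / e) * π ^ (m % e)) * hz

/-- The ring homomorphisms `B → A` that agree with `ι` on `R` and are congruent to `ι` modulo a
uniformizer `π` of `B` form a finite set, provided that `π ^ e` is associated to an element of `R`
and that residues of `B` are simple roots of polynomials over `R`. -/
theorem finite_ringHom_congr {R B A : Type*} [CommRing R] [CommRing B] [IsLocalRing B]
    [CommRing A] [IsDomain A] [IsLocalRing A] (j : R →+* B) (ι : B →+* A) [IsLocalHom ι]
    {π w : B} {p : R} {e : ℕ} (he : 0 < e) (hπ : π ∈ maximalIdeal B) (hw : IsUnit w)
    (hπp : π ^ e = w * j p) (hsep : ∀ z : A, (∀ n : ℕ, ι π ^ n ∣ z) → z = 0)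
    (hres : ∀ x : B, ∃ f : R[X], π ∣ (f.map j).eval x ∧ IsUnit ((f.map j).derivative.eval x)) :
    {σ : B →+* A | σ.comp j = ι.comp j ∧ ∀ b, ι π ∣ σ b - ι b}.Finite := by
  set S := {σ : B →+* A | σ.comp j = ι.comp j ∧ ∀ b, ι π ∣ σ b - ι b} with hS
  have hιπ : ι π ∈ maximalIdeal A := by
    rw [mem_maximalIdeal] at hπ ⊢
    exact fun h => hπ (isUnit_of_map_unit ι _ h)
  have hσπ : ∀ σ ∈ S, ι π ∣ σ π := fun σ hσ => by
    simpa using dvd_add (hσ.2 π) (dvd_refl (ι π))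
  obtain ⟨w', hw'⟩ := hw.exists_right_inv
  by_contra hinf
  have : Infinite S := Set.infinite_coe_iff.2 hinf
  let g : Fin (e + 1) ↪ S := Fin.valEmbedding.trans (Infinite.natEmbedding S)
  let T : (Fin (e + 1) → A) →ₗ[A] (Fin e → A) :=
    LinearMap.pi fun k => Fintype.linearCombination A fun i => (g i).1 (π ^ (k : ℕ))
  have hT : ∀ a k, T a k = ∑ i, a i * (g i).1 (π ^ (k : ℕ)) := fun a k => by
    simp [T, Fintype.linearCombination_apply]
  have hnot : ¬ Function.Injective T := fun h => by
    simpa using card_le_of_injective A T h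
  obtain ⟨a, ha, ha0⟩ : ∃ a, T a = 0 ∧ a ≠ 0 := by
    by_contra! h
    exact hnot ((injective_iff_map_eq_zero T).2 h)
  have hzero : ∀ x : B, ∑ i, a i * (g i).1 x = 0 := by
    intro x
    refine hsep _ fun N => ?_
    let q := Ideal.Quotient.mk (Ideal.span {ι π ^ N})
    have hq : ∀ z, q z = 0 ↔ ι π ^ N ∣ z := fun z => by
      rw [Ideal.Quotient.eq_zero_iff_mem, Ideal.mem_span_singleton]
    let C : Subring B := ⨅ σ : S, RingHom.eqLocus (q.comp σ.1) (q.comp ι)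
    have hC : ∀ c, c ∈ C ↔ ∀ σ ∈ S, ι π ^ N ∣ σ c - ι c := fun c => by
      simp only [C, Subring.mem_iInf, RingHom.mem_eqLocus, RingHom.comp_apply, ← hq, map_sub,
        sub_eq_zero, Subtype.forall]
    have hpC : j p ∈ C := (hC _).2 fun σ hσ => by
      have := RingHom.congr_fun hσ.1 p
      simp only [RingHom.comp_apply] at this
      simp [this]
    have happrox : ∀ x, ∃ c ∈ C, π ∣ x - c := by
      intro x
      obtain ⟨f, hf, hf'⟩ := hres x
      obtain ⟨c, hcx, hc⟩ := exists_dvd_pow_eval hπ (f.map j) hf hf' N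
      refine ⟨c, (hC c).2 fun σ hσ => ?_, (dvd_sub_comm).1 hcx⟩
      have hc' : π ^ N ∣ (f.map j).eval c := (pow_dvd_pow _ N.le_succ).trans hc
      have hu := isUnit_eval_of_dvd_sub hπ (f.map j).derivative hcx hf'
      refine pow_dvd_sub_of_dvd_eval hιπ (f.map (ι.comp j)) (hσ.2 c) ?_ ?_ ?_
      · rw [← Polynomial.map_map, derivative_map, eval_map_apply]
        exact hu.map ι
      · rw [← Polynomial.map_map, eval_map_apply, ← map_pow]
        exact map_dvd ι hc'
      · rw [← hσ.1, ← Polynomial.map_map, eval_map_apply]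
        refine dvd_trans (pow_dvd_pow_of_dvd (hσπ σ hσ) N) ?_
        rw [← map_pow]
        exact map_dvd σ hc'
    obtain ⟨c, hc, y, hy⟩ := exists_pow_dvd_sub_sum C he hpC hw' hπp happrox N x
    have hx : x = ∑ k, c k * π ^ (k : ℕ) + π ^ N * y := by rw [← hy]; ring
    have key : ∀ i, q ((g i).1 x) = ∑ k, q (ι (c k)) * q ((g i).1 (π ^ (k : ℕ))) := fun i => by
      have h0 : q ((g i).1 (π ^ N * y)) = 0 := by
        rw [hq, map_mul, map_pow]
        exact (pow_dvd_pow_of_dvd (hσπ _ (g i).2) N).mul_right _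
      rw [hx, map_add, map_add, h0, add_zero, map_sum, map_sum]
      refine Finset.sum_congr rfl fun k _ => ?_
      rw [map_mul, map_mul]
      congr 1
      rw [← sub_eq_zero, ← map_sub, hq]
      exact (hC _).1 (hc k) _ (g i).2
    rw [← hq, map_sum]
    simp only [map_mul, key, Finset.mul_sum]
    rw [Finset.sum_comm]
    refine Finset.sum_eq_zero fun k _ => ?_
    have h1 : ∑ i, q (a i) * q ((g i).1 (π ^ (k : ℕ))) = 0 := by
      have := congr_arg q ((hT a k).symm.trans (congr_fun ha k))
      simpa only [map_sum, map_mul, Pi.zero_apply, map_zero] using this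
    calc _ = q (ι (c k)) * ∑ i, q (a i) * q ((g i).1 (π ^ (k : ℕ))) := by
          rw [Finset.mul_sum]; exact Finset.sum_congr rfl fun i _ => by ring
      _ = 0 := by rw [h1, mul_zero]
  have hli := (linearIndependent_monoidHom B A).comp
    (fun i : Fin (e + 1) => ((g i).1 : B →* A)) (fun i i' h => g.injective (Subtype.ext
      (RingHom.ext fun b => DFunLike.congr_fun h b)))
  rw [Fintype.linearIndependent_iff] at hli
  refine ha0 (funext fun i => hli a ?_ i)
  ext x
  simpa using hzero x

/-- Over a local ring with perfect residue field, every residually algebraic element is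
congruent to a simple root. -/
theorem exists_simple_root {R B : Type*} [CommRing R] [IsLocalRing R] [CommRing B] [IsLocalRing B]
    (j : R →+* B) [IsLocalHom j] [PerfectField (ResidueField R)] (x : B)
    (halg : ∃ f : R[X], f.map (residue R) ≠ 0 ∧ (f.map j).eval x ∈ maximalIdeal B) :
    ∃ f : R[X], (f.map j).eval x ∈ maximalIdeal B ∧ IsUnit ((f.map j).derivative.eval x) := by
  let _ : Algebra (ResidueField R) (ResidueField B) := (ResidueField.map j).toAlgebra
  have hev : ∀ f : R[X], residue B ((f.map j).eval x) =
      aeval (residue B x) (f.map (residue R)) := fun f => by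
    rw [← eval_map_apply, Polynomial.map_map, aeval_def, eval₂_eq_eval_map, Polynomial.map_map]
    rfl
  obtain ⟨f, hf, hfx⟩ := halg
  have hint : IsIntegral (ResidueField R) (residue B x) := by
    refine IsAlgebraic.isIntegral ⟨f.map (residue R), hf, ?_⟩
    rw [← hev, residue_eq_zero_iff]
    exact hfx
  obtain ⟨F, hF⟩ := Polynomial.map_surjective _ (residue_surjective (R := R))
    (minpoly (ResidueField R) (residue B x))
  refine ⟨F, ?_, ?_⟩
  · rw [← residue_eq_zero_iff, hev, hF, minpoly.aeval]
  · rw [derivative_map, ← notMem_maximalIdeal, ← residue_eq_zero_iff, hev, ← derivative_map, hF]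
    exact (PerfectField.separable_of_irreducible (minpoly.irreducible hint)).aeval_derivative_ne_zero
      (minpoly.aeval _ _)

end Approximation

section Primitive

open Set

variable {g : ℝ → ℕ}

theorem intervalIntegrable_of_antitoneOn_Ici (hg : AntitoneOn g (Ici 0)) (c : ℝ) {r s : ℝ}
    (hr : 0 ≤ r) (hs : 0 ≤ s) :
    IntervalIntegrable (fun t => (g t : ℝ) / c) MeasureTheory.volume r s := by
  have : AntitoneOn (fun t => (g t : ℝ)) (uIcc r s) := fun a ha b hb hab =>
    Nat.cast_le.2 (hg (le_trans (le_min hr hs) ha.1) (le_trans (le_min hr hs) hb.1) hab)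
  exact this.intervalIntegrable.div_const c

theorem primitive_sub_primitive (hg : AntitoneOn g (Ici 0)) (c : ℝ) {r s : ℝ}
    (hr : 0 ≤ r) (hs : 0 ≤ s) :
    (∫ t in (0 : ℝ)..s, (g t : ℝ) / c) - ∫ t in (0 : ℝ)..r, (g t : ℝ) / c =
      ∫ t in r..s, (g t : ℝ) / c :=
  intervalIntegral.integral_interval_sub_left
    (intervalIntegrable_of_antitoneOn_Ici hg c le_rfl hs)
    (intervalIntegrable_of_antitoneOn_Ici hg c le_rfl hr)

theorem sub_div_le_integral (hg : AntitoneOn g (Ici 0)) (hpos : ∀ t, 0 ≤ t → 1 ≤ g t) {r s : ℝ}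
    (hr : 0 ≤ r) (hrs : r ≤ s) :
    (s - r) / g 0 ≤ ∫ t in r..s, (g t : ℝ) / g 0 := by
  have h := intervalIntegral.integral_mono_on hrs
    (intervalIntegrable_const (c := (1 : ℝ) / g 0))
    (intervalIntegrable_of_antitoneOn_Ici hg (g 0) hr (hr.trans hrs)) fun x hx => by
      have : (1 : ℝ) ≤ g x := by exact_mod_cast hpos x (hr.trans hx.1)
      gcongr
  rw [intervalIntegral.integral_const, smul_eq_mul] at h
  rwa [div_eq_mul_one_div]

theorem integral_le_sub (hg : AntitoneOn g (Ici 0)) (hpos : ∀ t, 0 ≤ t → 1 ≤ g t) {r s : ℝ}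
    (hr : 0 ≤ r) (hrs : r ≤ s) :
    ∫ t in r..s, (g t : ℝ) / g 0 ≤ s - r := by
  have h := intervalIntegral.integral_mono_on hrs
    (intervalIntegrable_of_antitoneOn_Ici hg (g 0) hr (hr.trans hrs))
    (intervalIntegrable_const (c := (1 : ℝ))) fun x hx => by
      have h0 : (0 : ℝ) < g 0 := by exact_mod_cast hpos 0 le_rfl
      rw [div_le_one h0]
      exact_mod_cast hg self_mem_Ici (hr.trans hx.1) (hr.trans hx.1)
  rwa [intervalIntegral.integral_const, smul_eq_mul, mul_one] at h

theorem exists_eqOn_Ioo_right (hg : AntitoneOn g (Ici 0)) {r : ℝ} (hr : 0 ≤ r) :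
    ∃ δ > 0, ∃ n, ∀ t ∈ Ioo r (r + δ), g t = n := by
  have hne : (g '' Ioc r (r + 1)).Nonempty := ⟨_, mem_image_of_mem g ⟨by linarith, le_rfl⟩⟩
  have hbdd : BddAbove (g '' Ioc r (r + 1)) := ⟨g r, by
    rintro _ ⟨t, ht, rfl⟩
    exact hg hr (hr.trans ht.1.le) ht.1.le⟩
  obtain ⟨t₀, ht₀, h⟩ := Nat.sSup_mem hne hbdd
  refine ⟨t₀ - r, sub_pos.2 ht₀.1, g t₀, fun t ht => le_antisymm ?_ ?_⟩
  · rw [h]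
    exact le_csSup hbdd ⟨t, ⟨ht.1, by linarith [ht.2, ht₀.2]⟩, rfl⟩
  · exact hg (hr.trans ht.1.le) (hr.trans ht₀.1.le) (by linarith [ht.2])

theorem exists_eqOn_Ioo_left (hg : AntitoneOn g (Ici 0)) {r : ℝ} (hr : 0 < r) :
    ∃ δ > 0, δ ≤ r ∧ ∃ n, ∀ t ∈ Ioo (r - δ) r, g t = n := by
  have hne : (g '' Ico 0 r).Nonempty := ⟨_, mem_image_of_mem g ⟨le_rfl, hr⟩⟩
  obtain ⟨t₀, ht₀, h⟩ := Nat.sInf_mem hne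
  refine ⟨r - t₀, sub_pos.2 ht₀.2, by linarith [ht₀.1], g t₀, fun t ht => le_antisymm ?_ ?_⟩
  · exact hg ht₀.1 (by linarith [ht.1, ht₀.1] : (0 : ℝ) ≤ t) (by linarith [ht.1])
  · rw [h]
    exact Nat.sInf_le ⟨t, ⟨by linarith [ht.1, ht₀.1], ht.2⟩, rfl⟩

theorem integral_eq_of_eqOn_Ioo {a b r s : ℝ} {n : ℕ} (c : ℝ) (h : ∀ t ∈ Ioo a b, g t = n)
    (hr : r ∈ Icc a b) (hs : s ∈ Icc a b) :
    ∫ t in r..s, (g t : ℝ) / c = (s - r) * (n / c) := by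
  rw [intervalIntegral.integral_congr_uIoo (g := fun _ => (n : ℝ) / c),
    intervalIntegral.integral_const, smul_eq_mul]
  intro t ht
  simp only [h t ⟨lt_of_le_of_lt (le_min hr.1 hs.1) ht.1, lt_of_lt_of_le ht.2 (max_le hr.2 hs.2)⟩]

/-- The normalized primitive of an antitone function with values in the positive integers is a
piecewise-linear self-homeomorphism of `[0, ∞)`. -/
theorem primitive_self_homeomorphism (hg : AntitoneOn g (Ici 0)) (hpos : ∀ t, 0 ≤ t → 1 ≤ g t)
    {φ : ℝ → ℝ} (hφ : ∀ r, φ r = ∫ t in (0 : ℝ)..r, (g t : ℝ) / g 0) :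
    ContinuousOn φ (Ici 0) ∧ StrictMonoOn φ (Ici 0) ∧ BijOn φ (Ici 0) (Ici 0) ∧
    (∀ r : ℝ, 0 ≤ r → ∃ δ : ℝ, 0 < δ ∧ ∃ a b : ℝ, ∀ s ∈ Icc r (r + δ), φ s = a * s + b) ∧
    (∀ r : ℝ, 0 < r → ∃ δ : ℝ, 0 < δ ∧ δ ≤ r ∧ ∃ a b : ℝ,
      ∀ s ∈ Icc (r - δ) r, φ s = a * s + b) ∧
    (∃ ψ : ℝ → ℝ, ContinuousOn ψ (Ici 0) ∧ MapsTo ψ (Ici 0) (Ici 0) ∧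
      ∀ r ∈ Ici (0 : ℝ), ψ (φ r) = r ∧ φ (ψ r) = r) := by
  have h0 : (0 : ℝ) < g 0 := by exact_mod_cast hpos 0 le_rfl
  have hsub : ∀ {r s : ℝ}, 0 ≤ r → 0 ≤ s → φ s - φ r = ∫ t in r..s, (g t : ℝ) / g 0 :=
    fun hr hs => by rw [hφ, hφ, primitive_sub_primitive hg _ hr hs]
  have hlow : ∀ {r s : ℝ}, 0 ≤ r → r ≤ s → (s - r) / g 0 ≤ φ s - φ r := fun hr hrs => by
    rw [hsub hr (hr.trans hrs)]
    exact sub_div_le_integral hg hpos hr hrs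
  have hupp : ∀ {r s : ℝ}, 0 ≤ r → r ≤ s → φ s - φ r ≤ s - r := fun hr hrs => by
    rw [hsub hr (hr.trans hrs)]
    exact integral_le_sub hg hpos hr hrs
  have hmono : StrictMonoOn φ (Ici 0) := fun r hr s _ hrs => by
    have := hlow hr hrs.le
    have : 0 < (s - r) / g 0 := div_pos (sub_pos.2 hrs) h0
    linarith
  have hcont : ContinuousOn φ (Ici 0) := by
    refine (LipschitzOnWith.of_le_add_mul 1 fun s hs r hr => ?_).continuousOn
    rcases le_total r s with h | h
    · have := hupp hr h
      simp only [NNReal.coe_one, one_mul, Real.dist_eq, abs_of_nonneg (sub_nonneg.2 h)]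
      linarith
    · have := hmono.monotoneOn hs hr h
      have := dist_nonneg (x := s) (y := r)
      simp only [NNReal.coe_one, one_mul]
      linarith
  have hφ0 : φ 0 = 0 := by simp [hφ]
  have hmaps : MapsTo φ (Ici 0) (Ici 0) := fun r hr => by
    have := hmono.monotoneOn self_mem_Ici hr hr
    rwa [hφ0] at this
  have hsurj : SurjOn φ (Ici 0) (Ici 0) := fun y hy => by
    have hy0 : (0 : ℝ) ≤ g 0 * y := mul_nonneg h0.le hy
    have h1 := hlow le_rfl hy0
    rw [hφ0, sub_zero, sub_zero, mul_div_cancel_left₀ _ h0.ne'] at h1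
    obtain ⟨x, hx, hxy⟩ := intermediate_value_Icc hy0 (hcont.mono Icc_subset_Ici_self)
      (show y ∈ Icc (φ 0) (φ (g 0 * y)) from ⟨by rwa [hφ0], h1⟩)
    exact ⟨x, hx.1, hxy⟩
  have hbij : BijOn φ (Ici 0) (Ici 0) := ⟨hmaps, hmono.injOn, hsurj⟩
  refine ⟨hcont, hmono, hbij, fun r hr => ?_, fun r hr => ?_, ?_⟩
  · obtain ⟨δ, hδ, n, hn⟩ := exists_eqOn_Ioo_right hg hr
    refine ⟨δ, hδ, n / g 0, φ r - r * (n / g 0), fun s hs => ?_⟩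
    have h1 := hsub hr (hr.trans hs.1)
    rw [integral_eq_of_eqOn_Ioo _ hn ⟨le_rfl, hs.1.trans hs.2⟩ hs] at h1
    linear_combination h1
  · obtain ⟨δ, hδ, hδr, n, hn⟩ := exists_eqOn_Ioo_left hg hr
    refine ⟨δ, hδ, hδr, n / g 0, φ r - r * (n / g 0), fun s hs => ?_⟩
    have h1 := hsub hr.le (by linarith [hs.1] : (0 : ℝ) ≤ s)
    rw [integral_eq_of_eqOn_Ioo _ hn ⟨hs.1.trans hs.2, le_rfl⟩ hs] at h1
    linear_combination h1
  · let ψ := Function.invFunOn φ (Ici 0)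
    have hinv : InvOn ψ φ (Ici 0) (Ici 0) := hbij.invOn_invFunOn
    have hψ : MapsTo ψ (Ici 0) (Ici 0) := hsurj.mapsTo_invFunOn
    refine ⟨ψ, ?_, hψ, fun r hr => ⟨hinv.1 hr, hinv.2 hr⟩⟩
    refine (LipschitzOnWith.of_le_add_mul (g 0 : NNReal) fun y hy x hx => ?_).continuousOn
    rcases le_total (ψ x) (ψ y) with h | h
    · have h1 := hlow (hψ hx) h
      rw [hinv.2 hx, hinv.2 hy, div_le_iff₀ h0] at h1
      have h2 : (y - x) * g 0 ≤ dist y x * g 0 :=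
        mul_le_mul_of_nonneg_right (Real.dist_eq y x ▸ le_abs_self _) h0.le
      simp only [NNReal.coe_natCast]
      linarith
    · have : (0 : ℝ) ≤ ((g 0 : NNReal) : ℝ) * dist y x := by positivity
      linarith

end Primitive

namespace AddVal

open IsLocalRing Polynomial

variable {Ω : Type*} [Field Ω] (V : AddVal Ω)

theorem v_one : V.v 1 = 0 := by
  have h := V.v_mul 1 1
  have h1 := V.v_ne_top 1 one_ne_zero
  rw [mul_one] at h
  lift V.v 1 to ℝ using h1 with a
  norm_cast at h ⊢
  linarith

theorem v_neg (x : Ω) : V.v (-x) = V.v x := by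
  have h : V.v (-1) = 0 := by
    have h := V.v_mul (-1) (-1)
    have h1 := V.v_ne_top (-1) (neg_ne_zero.2 one_ne_zero)
    rw [neg_mul_neg, mul_one, v_one] at h
    lift V.v (-1) to ℝ using h1 with a
    norm_cast at h ⊢
    linarith
  rw [neg_eq_neg_one_mul, V.v_mul, h, zero_add]

theorem v_eq_top_iff {x : Ω} : V.v x = ⊤ ↔ x = 0 :=
  ⟨fun h => by_contra fun hx => V.v_ne_top x hx h, fun h => h ▸ V.v_zero⟩

theorem v_pow {x : Ω} {r : ℝ} (h : V.v x = (r : WithTop ℝ)) (n : ℕ) :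
    V.v (x ^ n) = ((n * r : ℝ) : WithTop ℝ) := by
  induction n with
  | zero => simp [v_one]
  | succ n ih =>
    rw [pow_succ, V.v_mul, ih, h]
    norm_cast
    push_cast
    ring

/-- The valuation ring of the restriction of `V` to `K`. -/
def integers (K : Type*) [Field K] [Algebra K Ω] : ValuationSubring K where
  carrier := {x | 0 ≤ V.v (algebraMap K Ω x)}
  mul_mem' {a b} ha hb := by
    simp only [Set.mem_ofPred_eq, map_mul, V.v_mul] at *
    exact add_nonneg ha hb
  one_mem' := by simp [v_one]
  add_mem' {a b} ha hb := by
    simp only [Set.mem_ofPred_eq, map_add] at *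
    exact (le_min ha hb).trans (V.v_min_le_add _ _)
  zero_mem' := by simp [V.v_zero]
  neg_mem' {a} ha := by simpa [v_neg] using ha
  mem_or_inv_mem' x := by
    rcases eq_or_ne x 0 with rfl | hx
    · left; simp [V.v_zero]
    have hx' : algebraMap K Ω x ≠ 0 := by simpa using hx
    have h := V.v_mul (algebraMap K Ω x) (algebraMap K Ω x)⁻¹
    rw [mul_inv_cancel₀ hx', v_one] at h
    simp only [Set.mem_ofPred_eq, map_inv₀]
    have h1 := V.v_ne_top _ hx'
    have h2 := V.v_ne_top _ (inv_ne_zero hx')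
    lift V.v (algebraMap K Ω x) to ℝ using h1 with a
    lift V.v (algebraMap K Ω x)⁻¹ to ℝ using h2 with b
    norm_cast at h ⊢
    by_contra! hcon
    linarith [hcon.1, hcon.2]

section integers

variable {V} {K : Type*} [Field K] [Algebra K Ω]

theorem mem_integers {x : K} : x ∈ V.integers K ↔ 0 ≤ V.v (algebraMap K Ω x) := Iff.rfl

theorem integers_dvd_iff {x y : V.integers K} :
    x ∣ y ↔ V.v (algebraMap K Ω x) ≤ V.v (algebraMap K Ω y) := by
  constructor
  · rintro ⟨z, rfl⟩
    simpa [V.v_mul] using add_le_add_right (mem_integers.1 z.2) (V.v (algebraMap K Ω x))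
  · intro h
    rcases eq_or_ne (x : K) 0 with hx | hx
    · rw [hx, map_zero, V.v_zero, top_le_iff, v_eq_top_iff, map_eq_zero] at h
      rw [show y = 0 from Subtype.ext h]
      exact dvd_zero _
    · have hx' : algebraMap K Ω x ≠ 0 := by simpa using hx
      have hmul : (x : K) * (y / x) = y := mul_div_cancel₀ _ hx
      refine ⟨⟨y / x, mem_integers.2 ?_⟩, Subtype.ext hmul.symm⟩
      rw [← hmul, map_mul, V.v_mul] at h
      exact WithTop.le_of_add_le_add_left (V.v_ne_top _ hx') (by rwa [add_zero])

theorem isUnit_integers_iff {x : V.integers K} : IsUnit x ↔ V.v (algebraMap K Ω x) = 0 := by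
  rw [isUnit_iff_dvd_one, integers_dvd_iff]
  simpa [v_one] using
    ⟨fun h => le_antisymm h (mem_integers.1 x.2), fun h => h.le⟩

theorem mem_maximalIdeal_integers_iff {x : V.integers K} :
    x ∈ maximalIdeal (V.integers K) ↔ 0 < V.v (algebraMap K Ω x) := by
  rw [mem_maximalIdeal, mem_nonunits_iff, isUnit_integers_iff, (mem_integers.1 x.2).lt_iff_ne,
    ne_comm]

variable (V) {L : Type*} [Field L] [Algebra L Ω]

/-- A ring homomorphism mapping integral elements to integral elements, restricted to the
valuation rings. -/
abbrev integersMap (f : K →+* L) (hf : ∀ x ∈ V.integers K, f x ∈ V.integers L) :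
    V.integers K →+* V.integers L :=
  RingHom.restrict f (V.integers K) (V.integers L) hf

theorem isLocalHom_integersMap (f : K →+* L) (hf : (algebraMap L Ω).comp f = algebraMap K Ω)
    (hf' : ∀ x ∈ V.integers K, f x ∈ V.integers L) : IsLocalHom (V.integersMap f hf') := by
  refine ⟨fun x hx => ?_⟩
  rw [isUnit_integers_iff] at hx ⊢
  rw [← hf]
  exact hx

theorem perfectField_residueField (h : V.HasPerfectResidueFieldOn K) :
    PerfectField (ResidueField (V.integers K)) := by
  rcases CharP.exists' (ResidueField (V.integers K)) with h0 | ⟨p, hp, hchar⟩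
  · exact PerfectField.ofCharZero
  · have hpm : 0 < V.v (algebraMap K Ω (p : K)) := by
      have : (p : V.integers K) ∈ maximalIdeal (V.integers K) := by
        rw [← residue_eq_zero_iff, map_natCast, CharP.cast_eq_zero]
      simpa using mem_maximalIdeal_integers_iff.1 this
    have : PerfectRing (ResidueField (V.integers K)) p := by
      refine PerfectRing.ofSurjective _ _ fun y => ?_
      obtain ⟨x, rfl⟩ := residue_surjective y
      obtain ⟨z, hz, hxz⟩ := h p hp.out hpm x (mem_integers.1 x.2)
      refine ⟨residue _ ⟨z, mem_integers.2 hz⟩, ?_⟩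
      rw [frobenius_def, ← map_pow, eq_comm, ← sub_eq_zero, ← map_sub, residue_eq_zero_iff,
        mem_maximalIdeal_integers_iff]
      exact hxz
    exact PerfectRing.toPerfectField _ p

/-- An element algebraic over `K` is a root of a polynomial over the valuation ring of `K` that
does not vanish over the residue field. -/
theorem exists_map_residue_ne_zero {x : Ω} (hx : IsAlgebraic K x) :
    ∃ f : (V.integers K)[X], f.map (residue _) ≠ 0 ∧
      (f.map (algebraMap (V.integers K) K)).aeval x = 0 := by
  obtain ⟨P, hP, hPx⟩ := hx
  obtain ⟨i, hi, hmin⟩ := P.support.exists_min_image (fun i => V.v (algebraMap K Ω (P.coeff i)))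
    (Polynomial.support_nonempty.2 hP)
  have hc : P.coeff i ≠ 0 := Polynomial.mem_support_iff.1 hi
  have hc' : algebraMap K Ω (P.coeff i) ≠ 0 := by simpa using hc
  have hint : ∀ n, (P * C (P.coeff i)⁻¹).coeff n ∈ V.integers K := fun n => by
    rw [coeff_mul_C, mem_integers]
    by_cases hn : n ∈ P.support
    · have h := hmin n hn
      have hmul : P.coeff n = P.coeff i * (P.coeff n * (P.coeff i)⁻¹) := by field_simp
      rw [hmul, map_mul, V.v_mul] at h
      exact WithTop.le_of_add_le_add_left (V.v_ne_top _ hc') (by rwa [add_zero])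
    · rw [Polynomial.notMem_support_iff.1 hn, zero_mul, map_zero, V.v_zero]
      exact le_top
  have hlifts : P * C (P.coeff i)⁻¹ ∈ Polynomial.lifts (algebraMap (V.integers K) K) :=
    (Polynomial.lifts_iff_coeff_lifts _).2 fun n => ⟨⟨_, hint n⟩, rfl⟩
  obtain ⟨f, hf⟩ := (Polynomial.mem_lifts _).1 hlifts
  refine ⟨f, fun h0 => ?_, ?_⟩
  · have h1 := congr_arg (fun q => Polynomial.coeff q i) h0
    have h2 : f.coeff i = 1 := Subtype.ext (by
      have := congr_arg (fun q => Polynomial.coeff q i) hf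
      simpa [hc] using this)
    simp [h2] at h1
  · rw [hf, map_mul, hPx, zero_mul]

end integers

/-- Only finitely many embeddings of a finitely ramified algebraic extension are
`Ξ_0`-equivalent to the inclusion. -/
theorem finite_xiRel_zero {V : AddVal Ω} {F : Type*} [Field F] [Algebra F Ω]
    [Algebra.IsAlgebraic F Ω] (hnorm : V.IsNormalizedOn F) (hperf : V.HasPerfectResidueFieldOn F)
    (E : IntermediateField F Ω) (e : ℕ) (he : V.IsRamIdx E e) :
    Finite {σ : ↥E →ₐ[F] Ω // xiRel V E e 0 σ E.val} := by
  obtain ⟨he0, hval, π₀, hπ₀⟩ := he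
  obtain ⟨p₀, hp₀⟩ := hnorm.2
  have he' : (0 : ℝ) < e := by exact_mod_cast he0
  have := V.perfectField_residueField hperf
  let j : V.integers F →+* V.integers E :=
    V.integersMap (algebraMap F E) fun x hx => hx
  let ι : V.integers E →+* V.integers Ω :=
    V.integersMap (algebraMap E Ω) fun x hx => hx
  have : IsLocalHom j := V.isLocalHom_integersMap _ rfl _
  have : IsLocalHom ι := V.isLocalHom_integersMap _ rfl _
  let π : V.integers E := ⟨π₀, mem_integers.2 (by
    change 0 ≤ V.v (π₀ : Ω); rw [hπ₀]; exact_mod_cast (by positivity : 0 ≤ 1 / (e : ℝ)))⟩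
  let p : V.integers F := ⟨p₀, mem_integers.2 (by rw [hp₀]; exact_mod_cast zero_le_one)⟩
  have hπ : π ∈ maximalIdeal (V.integers E) := by
    rw [mem_maximalIdeal_integers_iff]
    change 0 < V.v (π₀ : Ω)
    rw [hπ₀]
    exact_mod_cast (by positivity : 0 < 1 / (e : ℝ))
  have hdvd : ∀ x ∈ maximalIdeal (V.integers E), π ∣ x := fun x hx => by
    rw [mem_maximalIdeal_integers_iff] at hx
    rw [integers_dvd_iff]
    change V.v (π₀ : Ω) ≤ V.v ((x : E) : Ω)
    change 0 < V.v ((x : E) : Ω) at hx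
    rcases eq_or_ne (x : E) 0 with h0 | h0
    · rw [h0, ZeroMemClass.coe_zero, V.v_zero]
      exact le_top
    · obtain ⟨k, hk⟩ := hval x h0
      rw [hk] at hx ⊢
      rw [hπ₀]
      rw [← WithTop.coe_zero, WithTop.coe_lt_coe] at hx
      rw [WithTop.coe_le_coe]
      have hk0 : (0 : ℝ) < k := (div_pos_iff_of_pos_right he').1 hx
      have : (1 : ℝ) ≤ k := by exact_mod_cast (Int.cast_pos.1 hk0 : 0 < k)
      gcongr
  have hassoc : Associated (j p) (π ^ e) := by
    have h : V.v (algebraMap E Ω (j p)) = V.v (algebraMap E Ω ((π ^ e : V.integers E) : E)) := by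
      change V.v (algebraMap F Ω p₀) = V.v ((π₀ : Ω) ^ e)
      rw [hp₀, V.v_pow hπ₀, mul_one_div_cancel he'.ne']
    exact associated_of_dvd_dvd (integers_dvd_iff.2 h.le) (integers_dvd_iff.2 h.ge)
  obtain ⟨w, hw⟩ := hassoc
  have hsep : ∀ z : V.integers Ω, (∀ n : ℕ, ι π ^ n ∣ z) → z = 0 := fun z hz => by
    refine Subtype.ext (V.v_eq_top_iff.1 ?_)
    by_contra htop
    obtain ⟨r, hr⟩ := WithTop.ne_top_iff_exists.1 htop
    obtain ⟨n, hn⟩ := exists_nat_gt (r * e)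
    have h : V.v ((π₀ : Ω) ^ n) ≤ V.v z := integers_dvd_iff.1 (hz n)
    rw [V.v_pow hπ₀, ← hr] at h
    norm_cast at h
    rw [mul_one_div, div_le_iff₀ he'] at h
    linarith
  have hres : ∀ x : V.integers E, ∃ f : (V.integers F)[X],
      π ∣ (f.map j).eval x ∧ IsUnit ((f.map j).derivative.eval x) := fun x => by
    obtain ⟨f, hf, hf'⟩ := exists_simple_root j x (by
      obtain ⟨f, hf, hfx⟩ := V.exists_map_residue_ne_zero
        (Algebra.IsAlgebraic.isAlgebraic (R := F) ((x : E) : Ω))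
      refine ⟨f, hf, ?_⟩
      have h0 : (f.map j).eval x = 0 := by
        refine Subtype.ext (Subtype.ext ?_)
        have h1 : ((algebraMap E Ω).comp (V.integers E).subtype) ((f.map j).eval x) =
            aeval ((x : E) : Ω) (f.map (algebraMap (V.integers F) F)) := by
          rw [← eval_map_apply, Polynomial.map_map, aeval_def, eval₂_eq_eval_map,
            Polynomial.map_map]
          rfl
        exact h1.trans hfx
      rw [h0]
      exact zero_mem _)
    exact ⟨f, hdvd _ hf, hf'⟩
  have hfin := finite_ringHom_congr j ι he0 hπ w.isUnit (hw.symm.trans (mul_comm _ _)) hsep hres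
  have hxi : ∀ σ : ↥E →ₐ[F] Ω, xiRel V E e 0 σ E.val → ∀ x ∈ V.integers E,
      V.v (π₀ : Ω) ≤ V.v (σ x - x) := fun σ hσ x hx => by
    rw [hπ₀]
    simpa using hσ x hx
  have hint : ∀ σ : ↥E →ₐ[F] Ω, xiRel V E e 0 σ E.val → ∀ x ∈ V.integers E,
      (σ : E →+* Ω) x ∈ V.integers Ω := fun σ hσ x hx => by
    have h1 : σ x - x ∈ V.integers Ω := (mem_integers.1 π.2).trans (hxi σ hσ x hx)
    have h2 : (x : Ω) ∈ V.integers Ω := hx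
    simpa using add_mem h1 h2
  let G : {σ : ↥E →ₐ[F] Ω // xiRel V E e 0 σ E.val} →
      {σ : V.integers E →+* V.integers Ω | σ.comp j = ι.comp j ∧ ∀ b, ι π ∣ σ b - ι b} :=
    fun σ => ⟨V.integersMap (σ.1 : E →+* Ω) (hint σ.1 σ.2),
      RingHom.ext fun x => Subtype.ext (σ.1.commutes x),
      fun b => integers_dvd_iff.2 (hxi σ.1 σ.2 b b.2)⟩
  have := hfin.to_subtype
  refine Finite.of_injective G fun σ τ h => Subtype.ext (AlgHom.ext fun x => ?_)
  have hB : ∀ x ∈ V.integers E, σ.1 x = τ.1 x := fun x hx =>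
    congr_arg Subtype.val (RingHom.congr_fun (congr_arg Subtype.val h) ⟨x, hx⟩)
  rcases (V.integers E).mem_or_inv_mem x with hx | hx
  · exact hB x hx
  · simpa using hB _ hx

end AddVal

theorem xiRel_val {Ω : Type*} [Field Ω] (V : AddVal Ω) {K : Type*} [Field K] [Algebra K Ω]
    (E : IntermediateField K Ω) (e : ℕ) (r : ℝ) : xiRel V E e r E.val E.val := fun x _ => by
  rw [sub_self, V.v_zero]
  exact le_top

theorem xiRel_mono {Ω : Type*} [Field Ω] {V : AddVal Ω} {K : Type*} [Field K] [Algebra K Ω]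
    {E : IntermediateField K Ω} {e : ℕ} {r s : ℝ} (hrs : r ≤ s) {σ τ : ↥E →ₐ[K] Ω}
    (h : xiRel V E e s σ τ) : xiRel V E e r σ τ := fun x hx => by
  refine le_trans ?_ (h x hx)
  rw [WithTop.coe_le_coe]
  gcongr

/-- The Herbrand function `φ_{E/F}` is a piecewise-linear, continuous,
strictly increasing bijection of `[0,∞)` onto itself (a self-homeomorphism of `[0,∞)`);
in particular it admits an inverse self-homeomorphism `ψ_{E/F}` of `[0,∞)`. -/
theorem herbrand_self_homeomorphism
    {F Ω : Type*} [Field F] [Field Ω] [Algebra F Ω] [IsSepClosure F Ω]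
    (V : AddVal Ω) (hnorm : V.IsNormalizedOn F) (hhens : V.IsHenselianOn F)
    (hperf : V.HasPerfectResidueFieldOn F)
    (E : IntermediateField F Ω) (e : ℕ) (he : V.IsRamIdx E e) :
    ContinuousOn (herbrand V E e) (Set.Ici (0 : ℝ)) ∧
    StrictMonoOn (herbrand V E e) (Set.Ici (0 : ℝ)) ∧
    Set.BijOn (herbrand V E e) (Set.Ici (0 : ℝ)) (Set.Ici (0 : ℝ)) ∧
    -- piecewise linearity: `φ` is affine on a small interval to the right of every
    -- `r ≥ 0`, and on a small interval to the left of every `r > 0`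
    (∀ r : ℝ, 0 ≤ r → ∃ δ : ℝ, 0 < δ ∧ ∃ a b : ℝ,
      ∀ s ∈ Set.Icc r (r + δ), herbrand V E e s = a * s + b) ∧
    (∀ r : ℝ, 0 < r → ∃ δ : ℝ, 0 < δ ∧ δ ≤ r ∧ ∃ a b : ℝ,
      ∀ s ∈ Set.Icc (r - δ) r, herbrand V E e s = a * s + b) ∧
    -- the inverse self-homeomorphism `ψ_{E/F}`
    (∃ ψ : ℝ → ℝ, ContinuousOn ψ (Set.Ici (0 : ℝ)) ∧
      Set.MapsTo ψ (Set.Ici (0 : ℝ)) (Set.Ici (0 : ℝ)) ∧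
      ∀ r ∈ Set.Ici (0 : ℝ), ψ (herbrand V E e r) = r ∧ herbrand V E e (ψ r) = r) := by
  have := IsSepClosure.separable (k := F) (K := Ω)
  have hfin := AddVal.finite_xiRel_zero hnorm hperf E e he
  have hfin' : ∀ t, 0 ≤ t → Finite {σ : ↥E →ₐ[F] Ω // xiRel V E e t σ E.val} := fun t ht =>
    Finite.of_injective _ (Subtype.impEmbedding _ _ fun _ => xiRel_mono ht).injective
  refine primitive_self_homeomorphism (g := gfun V E e) (fun r hr s _ hrs => ?_)
    (fun t ht => ?_) fun _ => rfl
  · have := hfin' r hr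
    exact Finite.card_le_of_embedding (Subtype.impEmbedding _ _ fun _ => xiRel_mono hrs)
  · have := hfin' t ht
    have : Nonempty {σ : ↥E →ₐ[F] Ω // xiRel V E e t σ E.val} := ⟨⟨E.val, xiRel_val V E e t⟩⟩
    exact Nat.card_pos
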